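/- Let p < q be primes with q ≡ 1 (mod p). If p^2*q^2 = p + a*p^2 + b*q^2 for nonnegative integers a, b, then a = (q^2 - 1)/p and b = p*(p-1). -/

import Mathlib

theorem stmt4 (p q : ℕ) (hp : p.Prime) (hq : q.Prime) (hpq : p < q)
    (hmod : q % p = 1) (a b : ℕ)
    (h : p ^ 2 * q ^ 2 = p + a * p ^ 2 + b * q ^ 2) :
    a = (q ^ 2 - 1) / p ∧ b = p * (p - 1) := by
  have hp0 : 0 < p := hp.pos
  have hb : p ∣ b := by
    have h1 : p ∣ b * q ^ 2 := by
      rw [← Nat.dvd_add_right (show p ∣ p + a * p ^ 2 from ⟨1 + a * p, by ring⟩), ← h]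
      exact ⟨p * q ^ 2, by ring⟩
    refine (hp.dvd_mul.1 h1).resolve_right fun h2 => ?_
    have h3 := Nat.mod_eq_zero_of_dvd (hp.dvd_of_dvd_pow h2)
    omega
  obtain ⟨c, rfl⟩ := hb
  have h1 : p * q ^ 2 = 1 + a * p + c * q ^ 2 :=
    Nat.eq_of_mul_eq_mul_left hp0 (by linear_combination h)
  have hc : c < p := by
    by_contra! hle
    have := Nat.mul_le_mul_right (q ^ 2) hle
    omega
  obtain ⟨d, rfl⟩ := Nat.exists_eq_add_of_lt hc
  have h2 : (d + 1) * q ^ 2 = 1 + a * (c + d + 1) := by linarith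
  have hq2 : q ^ 2 ≡ 1 [MOD c + d + 1] := by
    have hq1 : q ≡ 1 [MOD c + d + 1] := by
      rw [Nat.ModEq, hmod, Nat.mod_eq_of_lt hp.one_lt]
    simpa using hq1.pow 2
  have hd : c + d + 1 ∣ d := by
    have h3 : d + 1 ≡ 0 + 1 [MOD c + d + 1] := by
      have h4 := (hq2.mul_left (d + 1)).symm
      rw [h2, mul_one] at h4
      exact h4.trans (by simp [Nat.ModEq])
    exact (Nat.modEq_zero_iff_dvd).1 (Nat.ModEq.add_right_cancel' 1 h3)
  obtain rfl : d = 0 := Nat.eq_zero_of_dvd_of_lt hd (by omega)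
  have h3 : q ^ 2 = 1 + a * (c + 0 + 1) := by linarith
  refine ⟨?_, by simp⟩
  rw [h3, Nat.add_sub_cancel_left, Nat.mul_div_cancel _ hp0]
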